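/- Let Ω ⊂ ℝⁿ be a bounded QH-visibility domain such that (Ω, k_Ω) is Gromov hyperbolic, and let Φ : Ω̄^G → Ω̄^Euc be the continuous surjective extension of the identity map. Then Φ is a homeomorphism if and only if Ω has no geodesic loop in the Euclidean closure Ω̄^Euc. -/

import Mathlib

open Metric Set Filter Topology MeasureTheory
open scoped NNReal ENNReal

noncomputable section

variable {E : Type*} [NormedAddCommGroup E] [NormedSpace ℝ E]

/-- The quasihyperbolic length of a path `γ : [a, b] → Ω`, i.e. `∫ ‖γ'(t)‖ / δ_Ω(γ t) dt`. -/
def qhLength (Ω : Set E) (γ : ℝ → E) (a b : ℝ) : ℝ :=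
  ∫ t in a..b, ‖deriv γ t‖ / infDist (γ t) Ωᶜ

/-- Admissible (Lipschitz, i.e. rectifiable) paths joining `x` to `y` inside `Ω`. -/
def qhAdmissible (Ω : Set E) (x y : E) (γ : ℝ → E) (a b : ℝ) : Prop :=
  a ≤ b ∧ γ a = x ∧ γ b = y ∧ (∀ t ∈ Icc a b, γ t ∈ Ω) ∧
    ∃ K : ℝ≥0, LipschitzOnWith K γ (Icc a b)

/-- The quasihyperbolic distance `k_Ω` on a domain `Ω`. -/
def qhDist (Ω : Set E) (x y : E) : ℝ :=
  sInf { L : ℝ | ∃ γ a b, qhAdmissible Ω x y γ a b ∧ L = qhLength Ω γ a b }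

/-- `γ` is a (unit-speed) quasihyperbolic geodesic on the parameter set `s`. -/
def IsQHGeodesicOn (Ω : Set E) (γ : ℝ → E) (s : Set ℝ) : Prop :=
  (∀ t ∈ s, γ t ∈ Ω) ∧ ∀ a ∈ s, ∀ b ∈ s, qhDist Ω (γ a) (γ b) = |a - b|

/-- `Ω` is a QH-visibility domain: any two distinct Euclidean boundary points have
neighbourhoods with disjoint closures together with a compact subset of `Ω` which is met by
every quasihyperbolic geodesic joining the two neighbourhoods. -/
def QHVisibilityDomain (Ω : Set E) : Prop :=
  ∀ p ∈ frontier Ω, ∀ q ∈ frontier Ω, p ≠ q →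
    ∃ U V : Set E, IsOpen U ∧ IsOpen V ∧ p ∈ U ∧ q ∈ V ∧
      closure U ∩ closure V = ∅ ∧
      ∃ K : Set E, IsCompact K ∧ K ⊆ Ω ∧
        ∀ (γ : ℝ → E) (T : ℝ), 0 ≤ T → IsQHGeodesicOn Ω γ (Icc 0 T) →
          γ 0 ∈ U → γ T ∈ V → ∃ t ∈ Icc 0 T, γ t ∈ K

/-- The Gromov product with respect to the quasihyperbolic distance. -/
def qhGromovProd (Ω : Set E) (o x y : E) : ℝ :=
  (qhDist Ω x o + qhDist Ω o y - qhDist Ω x y) / 2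

/-- `(Ω, k_Ω)` is Gromov hyperbolic (four-point condition on the Gromov product). -/
def QHGromovHyperbolic (Ω : Set E) : Prop :=
  ∃ δ : ℝ, 0 ≤ δ ∧ ∀ o ∈ Ω, ∀ x ∈ Ω, ∀ y ∈ Ω, ∀ z ∈ Ω,
    min (qhGromovProd Ω o x y) (qhGromovProd Ω o y z) - δ ≤ qhGromovProd Ω o x z

/-- A quasihyperbolic geodesic line. -/
def IsQHGeodesicLine (Ω : Set E) (γ : ℝ → E) : Prop :=
  IsQHGeodesicOn Ω γ univ

/-- `Ω` has no geodesic loop in its Euclidean closure: no quasihyperbolic geodesic line has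
equal cluster sets at `+∞` and `-∞`. -/
def NoGeodesicLoop (Ω : Set E) : Prop :=
  ∀ γ : ℝ → E, IsQHGeodesicLine Ω γ →
    {x : E | MapClusterPt x atTop γ} ≠ {x : E | MapClusterPt x atBot γ}

section GromovClosure

variable {X : Type*} [TopologicalSpace X] (d : X → X → ℝ) (o : X)

/-- The Gromov product of the distance function `d` with base point `o`. -/
def gromovProdFun (x y : X) : ℝ := (d x o + d o y - d x y) / 2

/-- A Gromov sequence: the pairwise Gromov products tend to infinity. -/
def IsGromovSeq (u : ℕ → X) : Prop :=
  ∀ M : ℝ, ∃ N : ℕ, ∀ m ≥ N, ∀ n ≥ N, M ≤ gromovProdFun d o (u m) (u n)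

/-- Equivalence of Gromov sequences. -/
def GromovSeqRel (u v : {u : ℕ → X // IsGromovSeq d o u}) : Prop :=
  Tendsto (fun k => gromovProdFun d o (u.1 k) (v.1 k)) atTop atTop

/-- The Gromov boundary: equivalence classes of Gromov sequences. -/
def GromovBdry := Quot (GromovSeqRel d o)

/-- The Gromov closure: the space together with its Gromov boundary. -/
def GromovCl := X ⊕ GromovBdry d o

/-- Inclusion of the space into the Gromov closure. -/
def GromovCl.pt (x : X) : GromovCl d o := Sum.inl x

/-- Inclusion of the Gromov boundary into the Gromov closure. -/
def GromovCl.bd (ξ : GromovBdry d o) : GromovCl d o := Sum.inr ξ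

/-- The sequences approximating a given point of the Gromov closure. -/
def gromovApproxSeqs : GromovCl d o → Set (ℕ → X) :=
  Sum.elim (fun x => ({fun _ => x} : Set (ℕ → X)))
    (fun ξ => {u | ∃ h : IsGromovSeq d o u, Quot.mk (GromovSeqRel d o) ⟨u, h⟩ = ξ})

/-- The Gromov product extended to the Gromov closure. -/
def extGromovProd (a b : GromovCl d o) : EReal :=
  sInf { r : EReal | ∃ u ∈ gromovApproxSeqs d o a, ∃ v ∈ gromovApproxSeqs d o b,
    r = Filter.liminf (fun k => ((gromovProdFun d o (u k) (v k) : ℝ) : EReal)) atTop }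

/-- The natural topology of the Gromov closure: generated by the open subsets of the space
together with the standard basic neighbourhoods of boundary points defined through the
extended Gromov product. -/
def gromovClTopology : TopologicalSpace (GromovCl d o) :=
  TopologicalSpace.generateFrom
    ({ S | ∃ U : Set X, IsOpen U ∧ S = GromovCl.pt d o '' U } ∪
     { S | ∃ (ξ : GromovBdry d o) (R : ℝ),
        S = { a | (R : EReal) < extGromovProd d o a (GromovCl.bd d o ξ) } })

end GromovClosure

/-- The quasihyperbolic distance on the subtype `Ω`. -/
def qhSubDist (Ω : Set E) : ↥Ω → ↥Ω → ℝ := fun x y => qhDist Ω ↑x ↑y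

/-- The Gromov boundary of `(Ω, k_Ω)`. -/
def QHGromovBoundary (Ω : Set E) (o : ↥Ω) := GromovBdry (qhSubDist Ω) o

/-- The Gromov closure of `(Ω, k_Ω)`. -/
def QHGromovClosure (Ω : Set E) (o : ↥Ω) := GromovCl (qhSubDist Ω) o

instance (Ω : Set E) (o : ↥Ω) : TopologicalSpace (QHGromovClosure Ω o) :=
  gromovClTopology (qhSubDist Ω) o

/-- Inclusion of `Ω` into its Gromov closure. -/
def qhClPt (Ω : Set E) (o : ↥Ω) (x : ↥Ω) : QHGromovClosure Ω o :=
  GromovCl.pt (qhSubDist Ω) o x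

section Paths

variable {Ω : Set E}

theorem infDist_compl_pos (hO : IsOpen Ω) (hne : Ωᶜ.Nonempty) {x : E} (hx : x ∈ Ω) :
    0 < infDist x Ωᶜ :=
  (hO.isClosed_compl.notMem_iff_infDist_pos hne).1 (by simpa using hx)

theorem qhAdmissible.mono {x y : E} {γ : ℝ → E} {a b : ℝ} (h : qhAdmissible Ω x y γ a b)
    {s t : ℝ} (hs : a ≤ s) (hst : s ≤ t) (ht : t ≤ b) :
    qhAdmissible Ω (γ s) (γ t) γ s t := by
  obtain ⟨-, -, -, hΩ, K, hK⟩ := h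
  have hsub : Icc s t ⊆ Icc a b := Icc_subset_Icc hs ht
  exact ⟨hst, rfl, rfl, fun r hr => hΩ r (hsub hr), K, hK.mono hsub⟩

theorem qhAdmissible.exists_infDist_ge (hO : IsOpen Ω) (hne : Ωᶜ.Nonempty) {x y : E} {γ : ℝ → E}
    {a b : ℝ} (h : qhAdmissible Ω x y γ a b) :
    ∃ m > 0, ∀ t ∈ Icc a b, m ≤ infDist (γ t) Ωᶜ := by
  obtain ⟨hab, -, -, hΩ, K, hK⟩ := h
  have hc : ContinuousOn (fun t => infDist (γ t) Ωᶜ) (Icc a b) :=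
    (continuous_infDist_pt _).comp_continuousOn hK.continuousOn
  obtain ⟨t₀, ht₀, hmin⟩ := isCompact_Icc.exists_isMinOn (nonempty_Icc.2 hab) hc
  exact ⟨_, infDist_compl_pos hO hne (hΩ t₀ ht₀), fun t ht => hmin ht⟩

theorem qhAdmissible.intervalIntegrable [CompleteSpace E] (hO : IsOpen Ω) (hne : Ωᶜ.Nonempty)
    {x y : E} {γ : ℝ → E} {a b : ℝ} (h : qhAdmissible Ω x y γ a b) :
    IntervalIntegrable (fun t => ‖deriv γ t‖ / infDist (γ t) Ωᶜ) volume a b := by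
  obtain ⟨m, hm, hmle⟩ := h.exists_infDist_ge hO hne
  obtain ⟨hab, -, -, hΩ, K, hK⟩ := h
  have hc : ContinuousOn (fun t => (infDist (γ t) Ωᶜ)⁻¹) (Icc a b) :=
    ((continuous_infDist_pt _).comp_continuousOn hK.continuousOn).inv₀
      fun t ht => (hm.trans_le (hmle t ht)).ne'
  rw [intervalIntegrable_iff_integrableOn_Ioo_of_le hab]
  refine IntegrableOn.of_bound (C := K * m⁻¹) (by simp) ?_ ?_
  · simp only [div_eq_mul_inv]
    exact (stronglyMeasurable_deriv γ).norm.aestronglyMeasurable.mul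
      ((hc.mono Ioo_subset_Icc_self).aestronglyMeasurable measurableSet_Ioo)
  · filter_upwards [ae_restrict_mem measurableSet_Ioo] with t ht
    have h1 : ‖deriv γ t‖ ≤ K := norm_deriv_le_of_lipschitzOn (Icc_mem_nhds ht.1 ht.2) hK
    have h2 := hmle t (Ioo_subset_Icc_self ht)
    rw [Real.norm_of_nonneg (div_nonneg (norm_nonneg _) infDist_nonneg), div_eq_mul_inv]
    exact mul_le_mul h1 (inv_anti₀ hm h2) (inv_nonneg.2 infDist_nonneg) K.2

theorem qhLength_nonneg {γ : ℝ → E} {a b : ℝ} (hab : a ≤ b) : 0 ≤ qhLength Ω γ a b :=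
  intervalIntegral.integral_nonneg hab fun _ _ => div_nonneg (norm_nonneg _) infDist_nonneg

theorem qhDist_le_qhLength {x y : E} {γ : ℝ → E} {a b : ℝ} (h : qhAdmissible Ω x y γ a b) :
    qhDist Ω x y ≤ qhLength Ω γ a b := by
  refine csInf_le ⟨0, ?_⟩ ⟨γ, a, b, h, rfl⟩
  rintro _ ⟨γ, a, b, h, rfl⟩
  exact qhLength_nonneg h.1

theorem qhDist_nonneg (x y : E) : 0 ≤ qhDist Ω x y := by
  refine Real.sInf_nonneg ?_
  rintro _ ⟨γ, a, b, h, rfl⟩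
  exact qhLength_nonneg h.1

theorem qhDist_self {x : E} (hx : x ∈ Ω) : qhDist Ω x x = 0 := by
  refine le_antisymm ?_ (qhDist_nonneg x x)
  have h : qhAdmissible Ω x x (fun _ => x) 0 0 :=
    ⟨le_rfl, rfl, rfl, fun _ _ => hx, 0, (LipschitzWith.const x).lipschitzOnWith⟩
  simpa [qhLength] using qhDist_le_qhLength h

theorem qhAdmissible.symm {x y : E} {γ : ℝ → E} {a b : ℝ} (h : qhAdmissible Ω x y γ a b) :
    qhAdmissible Ω y x (fun t => γ (-t)) (-b) (-a) := by
  obtain ⟨hab, hx, hy, hΩ, K, hK⟩ := h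
  refine ⟨by linarith, by simpa, by simpa, fun t ht => hΩ _ ⟨?_, ?_⟩, K,
    LipschitzOnWith.of_dist_le_mul fun s hs t ht => ?_⟩
  · linarith [ht.2]
  · linarith [ht.1]
  · have := hK.dist_le_mul (-s) ⟨by linarith [hs.2], by linarith [hs.1]⟩
      (-t) ⟨by linarith [ht.2], by linarith [ht.1]⟩
    rwa [dist_neg_neg] at this

theorem qhLength_comp_neg (γ : ℝ → E) (a b : ℝ) :
    qhLength Ω (fun t => γ (-t)) (-b) (-a) = qhLength Ω γ a b := by
  have : ∀ t, ‖deriv (fun t => γ (-t)) t‖ / infDist (γ (-t)) Ωᶜ =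
      (fun t => ‖deriv γ t‖ / infDist (γ t) Ωᶜ) (-t) := by
    intro t
    simp [deriv_comp_neg]
  unfold qhLength
  simp_rw [this]
  rw [intervalIntegral.integral_comp_neg (fun t => ‖deriv γ t‖ / infDist (γ t) Ωᶜ)]
  simp

theorem qhDist_comm (x y : E) : qhDist Ω x y = qhDist Ω y x := by
  unfold qhDist
  congr 1
  ext L
  constructor
  all_goals
    rintro ⟨γ, a, b, h, rfl⟩
    exact ⟨_, _, _, h.symm, (qhLength_comp_neg γ a b).symm⟩

theorem qhAdmissible.trans [CompleteSpace E] (hO : IsOpen Ω) (hne : Ωᶜ.Nonempty) {x y z : E}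
    {γ η : ℝ → E} {a b c d : ℝ} (h : qhAdmissible Ω x y γ a b) (h' : qhAdmissible Ω y z η c d) :
    ∃ (σ : ℝ → E) (e : ℝ), qhAdmissible Ω x z σ a e ∧
      qhLength Ω σ a e = qhLength Ω γ a b + qhLength Ω η c d := by
  have hi := h.intervalIntegrable hO hne
  have hi' := h'.intervalIntegrable hO hne
  obtain ⟨hab, hx, hy, hΩ, K, hK⟩ := h
  obtain ⟨hcd, hy', hz, hΩ', K', hK'⟩ := h'
  set σ : ℝ → E := fun t => if t ≤ b then γ t else η (t + (c - b)) with hσ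
  have hσ1 : ∀ t ≤ b, σ t = γ t := fun t ht => by simp [hσ, ht]
  have hσ2 : ∀ t ≥ b, σ t = η (t + (c - b)) := fun t ht => by
    rcases ht.eq_or_lt with rfl | ht
    · simp [hσ, hy, hy']
    · simp [hσ, not_le.2 ht]
  have hlip1 : ∀ s ∈ Icc a b, ∀ t ∈ Icc a b, dist (σ s) (σ t) ≤ max K K' * dist s t := by
    intro s hs t ht
    rw [hσ1 s hs.2, hσ1 t ht.2]
    exact (hK.dist_le_mul s hs t ht).trans (by gcongr; exact le_max_left _ _)
  have hlip2 : ∀ s ∈ Icc b (d - (c - b)), ∀ t ∈ Icc b (d - (c - b)),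
      dist (σ s) (σ t) ≤ max K K' * dist s t := by
    intro s hs t ht
    rw [hσ2 s hs.1, hσ2 t ht.1]
    refine (hK'.dist_le_mul _ ⟨by linarith [hs.1], by linarith [hs.2]⟩ _
      ⟨by linarith [ht.1], by linarith [ht.2]⟩).trans ?_
    rw [dist_add_right]
    gcongr
    exact le_max_right _ _
  have hlip3 : ∀ s ∈ Icc a b, ∀ t ∈ Icc b (d - (c - b)),
      dist (σ s) (σ t) ≤ max K K' * dist s t := by
    intro s hs t ht
    have h1 := hlip1 s hs b ⟨hab, le_rfl⟩
    have h2 := hlip2 b ⟨le_rfl, by linarith⟩ t ht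
    have h3 : dist s t = dist s b + dist b t := by
      rw [Real.dist_eq, Real.dist_eq, Real.dist_eq, abs_of_nonpos, abs_of_nonpos, abs_of_nonpos]
      · ring
      all_goals linarith [hs.2, ht.1]
    rw [h3, mul_add]
    linarith [dist_triangle (σ s) (σ b) (σ t)]
  have hγ : ∫ t in a..b, ‖deriv σ t‖ / infDist (σ t) Ωᶜ =
      ∫ t in a..b, ‖deriv γ t‖ / infDist (γ t) Ωᶜ := by
    rw [intervalIntegral.integral_of_le hab, intervalIntegral.integral_of_le hab,
      integral_Ioc_eq_integral_Ioo, integral_Ioc_eq_integral_Ioo]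
    refine setIntegral_congr_fun measurableSet_Ioo fun t ht => ?_
    have he : σ =ᶠ[𝓝 t] γ := by
      filter_upwards [Iio_mem_nhds ht.2] with s hs using hσ1 s (le_of_lt hs)
    simp only [he.deriv_eq, he.self_of_nhds]
  have hE : EqOn (fun t => ‖deriv σ t‖ / infDist (σ t) Ωᶜ)
      (fun t => (fun t => ‖deriv η t‖ / infDist (η t) Ωᶜ) (t + (c - b))) (Ioo b (d - (c - b))) := by
    intro t ht
    have he : σ =ᶠ[𝓝 t] fun t => η (t + (c - b)) := by
      filter_upwards [Ioi_mem_nhds ht.1] with s hs using hσ2 s (le_of_lt hs)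
    simp only [he.deriv_eq, he.self_of_nhds, deriv_comp_add_const]
  have hη : ∫ t in b..(d - (c - b)), ‖deriv σ t‖ / infDist (σ t) Ωᶜ =
      ∫ t in c..d, ‖deriv η t‖ / infDist (η t) Ωᶜ := by
    have := intervalIntegral.integral_comp_add_right (a := b) (b := d - (c - b))
      (fun t => ‖deriv η t‖ / infDist (η t) Ωᶜ) (c - b)
    rw [add_sub_cancel, sub_add_cancel] at this
    rw [← this, intervalIntegral.integral_of_le (by linarith),
      intervalIntegral.integral_of_le (by linarith),
      integral_Ioc_eq_integral_Ioo, integral_Ioc_eq_integral_Ioo]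
    exact setIntegral_congr_fun measurableSet_Ioo hE
  have hadm : qhAdmissible Ω x z σ a (d - (c - b)) := by
    refine ⟨by linarith, by rw [hσ1 a hab, hx], ?_, ?_, max K K',
      LipschitzOnWith.of_dist_le_mul ?_⟩
    · rw [hσ2 _ (by linarith), sub_add_cancel, hz]
    · intro t ht
      rcases le_total t b with h | h
      · rw [hσ1 t h]; exact hΩ t ⟨ht.1, h⟩
      · rw [hσ2 t h]; exact hΩ' _ ⟨by linarith, by linarith [ht.2]⟩
    · intro s hs t ht
      rcases le_total s b with h1 | h1 <;> rcases le_total t b with h2 | h2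
      · exact hlip1 s ⟨hs.1, h1⟩ t ⟨ht.1, h2⟩
      · exact hlip3 s ⟨hs.1, h1⟩ t ⟨h2, ht.2⟩
      · rw [dist_comm, dist_comm s]
        exact hlip3 t ⟨ht.1, h2⟩ s ⟨h1, hs.2⟩
      · exact hlip2 s ⟨h1, hs.2⟩ t ⟨h2, ht.2⟩
  have hiσ := hadm.intervalIntegrable hO hne
  refine ⟨σ, d - (c - b), hadm, ?_⟩
  unfold qhLength
  rw [← hγ, ← hη, intervalIntegral.integral_add_adjacent_intervals]
  · exact hiσ.mono_set (by
      rw [uIcc_of_le hab, uIcc_of_le (by linarith)]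
      exact Icc_subset_Icc le_rfl (by linarith))
  · exact hiσ.mono_set (by
      rw [uIcc_of_le (by linarith), uIcc_of_le (by linarith)]
      exact Icc_subset_Icc hab le_rfl)

theorem qhAdmissible_segment {x y : E} {r : ℝ} (hr : r ≤ infDist x Ωᶜ)
    (hy : dist y x < r) : qhAdmissible Ω x y (AffineMap.lineMap x y) 0 1 ∧
      qhLength Ω (AffineMap.lineMap x y) 0 1 ≤ dist y x / (r - dist y x) := by
  have hd : ∀ t ∈ Icc (0 : ℝ) 1, r - dist y x ≤ infDist (AffineMap.lineMap x y t : E) Ωᶜ := by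
    intro t ht
    have h1 : infDist x Ωᶜ ≤ infDist (AffineMap.lineMap x y t : E) Ωᶜ +
        dist x (AffineMap.lineMap x y t : E) := infDist_le_infDist_add_dist
    have h2 : dist x (AffineMap.lineMap x y t : E) ≤ dist y x := by
      rw [dist_left_lineMap, Real.norm_of_nonneg ht.1, dist_comm]
      exact mul_le_of_le_one_left dist_nonneg ht.2
    linarith
  have hpos : 0 < r - dist y x := by linarith
  constructor
  · refine ⟨zero_le_one, by simp, by simp, fun t ht => ?_, nndist x y,
      (lipschitzWith_lineMap x y).lipschitzOnWith⟩
    by_contra hmem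
    have := hd t ht
    rw [infDist_zero_of_mem (show (AffineMap.lineMap x y t : E) ∈ Ωᶜ from hmem)] at this
    linarith
  · unfold qhLength
    have hder : ∀ t, deriv (AffineMap.lineMap x y : ℝ → E) t = y - x := fun t =>
      AffineMap.hasDerivAt_lineMap.deriv
    have := intervalIntegral.norm_integral_le_of_norm_le_const (a := 0) (b := 1)
      (f := fun t => ‖deriv (AffineMap.lineMap x y : ℝ → E) t‖ /
        infDist (AffineMap.lineMap x y t : E) Ωᶜ) (C := dist y x / (r - dist y x)) ?_
    · simpa using (le_abs_self _).trans this
    · intro t ht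
      rw [uIoc_of_le zero_le_one] at ht
      rw [Real.norm_of_nonneg (div_nonneg (norm_nonneg _) infDist_nonneg), hder, ← dist_eq_norm]
      exact div_le_div_of_nonneg_left dist_nonneg hpos (hd t ⟨ht.1.le, ht.2⟩)

theorem exists_qhAdmissible [CompleteSpace E] (hO : IsOpen Ω) (hne : Ωᶜ.Nonempty)
    (hC : IsPreconnected Ω) {x y : E} (hx : x ∈ Ω) (hy : y ∈ Ω) :
    ∃ γ a b, qhAdmissible Ω x y γ a b := by
  have hloc : ∀ z ∈ Ω, ∀ᶠ w in 𝓝[Ω] z, (∃ γ a b, qhAdmissible Ω z w γ a b) ∧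
      ∃ γ a b, qhAdmissible Ω w z γ a b := by
    intro z hz
    filter_upwards [mem_nhdsWithin_of_mem_nhds (ball_mem_nhds z (infDist_compl_pos hO hne hz))]
      with w hw
    have := (qhAdmissible_segment le_rfl hw).1
    exact ⟨⟨_, _, _, this⟩, _, _, _, this.symm⟩
  refine hC.induction₂' (fun x y => ∃ γ a b, qhAdmissible Ω x y γ a b) hloc ?_ hx hy
  rintro x y z - - - ⟨γ, a, b, h⟩ ⟨η, c, d, h'⟩
  obtain ⟨σ, e, hσ, -⟩ := h.trans hO hne h'
  exact ⟨_, _, _, hσ⟩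

theorem exists_qhLength_lt [CompleteSpace E] (hO : IsOpen Ω) (hne : Ωᶜ.Nonempty)
    (hC : IsPreconnected Ω) {x y : E} (hx : x ∈ Ω) (hy : y ∈ Ω) {ε : ℝ} (hε : 0 < ε) :
    ∃ γ a b, qhAdmissible Ω x y γ a b ∧ qhLength Ω γ a b < qhDist Ω x y + ε := by
  obtain ⟨γ, a, b, h⟩ := exists_qhAdmissible hO hne hC hx hy
  obtain ⟨_, ⟨γ, a, b, h, rfl⟩, hlt⟩ := exists_lt_of_csInf_lt
    (s := { L : ℝ | ∃ γ a b, qhAdmissible Ω x y γ a b ∧ L = qhLength Ω γ a b })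
    ⟨_, γ, a, b, h, rfl⟩ (lt_add_of_pos_right (qhDist Ω x y) hε)
  exact ⟨γ, a, b, h, hlt⟩

theorem qhDist_triangle [CompleteSpace E] (hO : IsOpen Ω) (hne : Ωᶜ.Nonempty)
    (hC : IsPreconnected Ω) {x y z : E} (hx : x ∈ Ω) (hy : y ∈ Ω) (hz : z ∈ Ω) :
    qhDist Ω x z ≤ qhDist Ω x y + qhDist Ω y z := by
  refine le_of_forall_pos_le_add fun ε hε => ?_
  obtain ⟨γ, a, b, h, hlt⟩ := exists_qhLength_lt hO hne hC hx hy (half_pos hε)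
  obtain ⟨η, c, d, h', hlt'⟩ := exists_qhLength_lt hO hne hC hy hz (half_pos hε)
  obtain ⟨σ, e, hσ, hl⟩ := h.trans hO hne h'
  linarith [qhDist_le_qhLength hσ]

theorem tendsto_qhDist_nhds (hO : IsOpen Ω) (hne : Ωᶜ.Nonempty) {x : E} (hx : x ∈ Ω) :
    Tendsto (fun y => qhDist Ω x y) (𝓝 x) (𝓝 0) := by
  have hr := infDist_compl_pos hO hne hx
  have h0 : Tendsto (fun y => dist y x) (𝓝 x) (𝓝 0) :=
    tendsto_iff_dist_tendsto_zero.1 tendsto_id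
  have h1 : Tendsto (fun y => dist y x / (infDist x Ωᶜ - dist y x)) (𝓝 x) (𝓝 0) := by
    simpa [Pi.div_def] using h0.div (h0.const_sub (infDist x Ωᶜ)) (by simpa using hr.ne')
  refine tendsto_of_tendsto_of_tendsto_of_le_of_le' tendsto_const_nhds h1
    (Eventually.of_forall fun y => qhDist_nonneg x y) ?_
  filter_upwards [ball_mem_nhds x hr] with y hy
  obtain ⟨h, hl⟩ := qhAdmissible_segment le_rfl hy
  exact (qhDist_le_qhLength h).trans hl

theorem abs_le_norm_of_hasDerivAt {γ : ℝ → E} {f : ℝ → ℝ} {γ' : E} {f' t : ℝ}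
    (hγ : HasDerivAt γ γ' t) (hf : HasDerivAt f f' t) (h : ∀ s, |f s - f t| ≤ ‖γ s - γ t‖) :
    |f'| ≤ ‖γ'‖ := by
  refine le_of_tendsto_of_tendsto (hasDerivAt_iff_tendsto_slope.1 hf).norm
    (hasDerivAt_iff_tendsto_slope.1 hγ).norm (Eventually.of_forall fun s => ?_)
  simp only [slope, norm_smul, vsub_eq_sub]
  exact mul_le_mul_of_nonneg_left (h s) (norm_nonneg _)

theorem log_infDist_sub_le_qhLength [FiniteDimensional ℝ E] (hO : IsOpen Ω) (hne : Ωᶜ.Nonempty)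
    {x y : E} {γ : ℝ → E} {a b : ℝ} (h : qhAdmissible Ω x y γ a b) :
    Real.log (infDist x Ωᶜ) - Real.log (infDist y Ωᶜ) ≤ qhLength Ω γ a b := by
  have : CompleteSpace E := FiniteDimensional.complete ℝ E
  have hi := h.intervalIntegrable hO hne
  obtain ⟨m, hm, hmle⟩ := h.exists_infDist_ge hO hne
  obtain ⟨hab, rfl, rfl, hΩ, K, hK⟩ := h
  set D : ℝ → ℝ := fun t => infDist (γ t) Ωᶜ with hD
  have hDγ : ∀ s t, |D s - D t| ≤ ‖γ s - γ t‖ := fun s t => by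
    have := (lipschitz_infDist_pt Ωᶜ).dist_le_mul (γ s) (γ t)
    simpa [Real.dist_eq, dist_eq_norm] using this
  have hDlip : LipschitzOnWith K D (Icc a b) := by
    simpa [Function.comp_def] using (lipschitz_infDist_pt Ωᶜ).comp_lipschitzOnWith hK
  have hlog : ∀ s ∈ Icc a b, ∀ t ∈ Icc a b, Real.log (D s) - Real.log (D t) ≤ m⁻¹ * |D s - D t| := by
    intro s hs t ht
    have h1 : 0 < D s := hm.trans_le (hmle s hs)
    have h2 : 0 < D t := hm.trans_le (hmle t ht)
    rw [← Real.log_div h1.ne' h2.ne']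
    refine (Real.log_le_sub_one_of_pos (div_pos h1 h2)).trans ?_
    rw [div_sub_one h2.ne', div_eq_inv_mul]
    exact (mul_le_mul_of_nonneg_left (le_abs_self _) (inv_pos.2 h2).le).trans
      (mul_le_mul_of_nonneg_right (inv_anti₀ hm (hmle t ht)) (abs_nonneg _))
  have hac : AbsolutelyContinuousOnInterval (fun t => Real.log (D t)) a b := by
    refine LipschitzOnWith.absolutelyContinuousOnInterval (K := m⁻¹.toNNReal * K) ?_
    rw [uIcc_of_le hab]
    refine LipschitzOnWith.of_dist_le_mul fun s hs t ht => ?_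
    have h3 := hDlip.dist_le_mul s hs t ht
    have h1 := hlog s hs t ht
    have h2 := hlog t ht s hs
    rw [abs_sub_comm] at h2
    rw [Real.dist_eq (D s)] at h3
    have h4 : m⁻¹ * |D s - D t| ≤ m⁻¹ * (K * dist s t) :=
      mul_le_mul_of_nonneg_left h3 (inv_pos.2 hm).le
    rw [Real.dist_eq, NNReal.coe_mul, Real.coe_toNNReal _ (inv_pos.2 hm).le, mul_assoc, abs_le]
    constructor <;> linarith
  have hftc := hac.integral_deriv_eq_sub
  have hle : -∫ t in a..b, deriv (fun t => Real.log (D t)) t ≤ qhLength Ω γ a b := by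
    rw [← intervalIntegral.integral_neg]
    refine intervalIntegral.integral_mono_ae_restrict hab hac.intervalIntegrable_deriv.neg hi ?_
    have e1 := (ae_restrict_iff' measurableSet_Icc).2 (hK.ae_differentiableWithinAt_of_mem (μ := volume))
    have e2 := (ae_restrict_iff' measurableSet_Icc).2 (hDlip.ae_differentiableWithinAt_of_mem (μ := volume))
    rw [← restrict_Ioo_eq_restrict_Icc] at *
    filter_upwards [e1, e2, ae_restrict_mem measurableSet_Ioo] with t h1 h2 ht
    have hn := Icc_mem_nhds ht.1 ht.2
    have h1 := (h1.differentiableAt hn).hasDerivAt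
    have h2 := (h2.differentiableAt hn).hasDerivAt
    have hpos : 0 < D t := hm.trans_le (hmle t (Ioo_subset_Icc_self ht))
    rw [(h2.log hpos.ne').deriv]
    have := abs_le_norm_of_hasDerivAt h1 h2 fun s => hDγ s t
    rw [← neg_div]
    exact div_le_div_of_nonneg_right ((neg_le_abs _).trans this) hpos.le
  rw [hftc] at hle
  linarith

end Paths
section GromovClosureLemmas

variable {X : Type*} {d : X → X → ℝ} {o : X} {δ : ℝ}

/-- `d` is a pseudometric which is `δ`-hyperbolic with respect to the base point `o`. -/
structure IsHyperbolicDist (d : X → X → ℝ) (o : X) (δ : ℝ) : Prop where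
  self : ∀ x, d x x = 0
  comm : ∀ x y, d x y = d y x
  triangle : ∀ x y z, d x z ≤ d x y + d y z
  four_point : ∀ x y z,
    min (gromovProdFun d o x y) (gromovProdFun d o y z) - δ ≤ gromovProdFun d o x z

/-- `d` is proper (in terms of ultrafilter limits) and any two points are joined by
`1`-Lipschitz curves which are almost geodesic. -/
structure IsProperLengthDist (d : X → X → ℝ) (o : X) : Prop where
  proper : ∀ (r : ℝ) (𝒰 : Ultrafilter ℕ) (f : ℕ → X), (∀ᶠ k in 𝒰, d o (f k) ≤ r) →
    ∃ y, Tendsto (fun k => d (f k) y) 𝒰 (𝓝 0)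
  length : ∀ x y, ∀ ε > 0, ∃ (L : ℝ) (f : ℝ → X), 0 ≤ L ∧ L ≤ d x y + ε ∧ f 0 = x ∧ f L = y ∧
    ∀ s ∈ Icc 0 L, ∀ t ∈ Icc 0 L, d (f s) (f t) ≤ |s - t|

namespace IsHyperbolicDist

theorem nonneg (H : IsHyperbolicDist d o δ) (x y : X) : 0 ≤ d x y := by
  have := H.triangle x y x
  rw [H.self, H.comm y x] at this
  linarith

theorem prod_comm (H : IsHyperbolicDist d o δ) (x y : X) :
    gromovProdFun d o x y = gromovProdFun d o y x := by
  simp only [gromovProdFun, H.comm x y, H.comm x o, H.comm o y]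
  ring

theorem prod_nonneg (H : IsHyperbolicDist d o δ) (x y : X) : 0 ≤ gromovProdFun d o x y := by
  have := H.triangle x o y
  simp only [gromovProdFun]
  linarith

theorem prod_self (H : IsHyperbolicDist d o δ) (x : X) : gromovProdFun d o x x = d o x := by
  simp only [gromovProdFun, H.self, H.comm x o]
  ring

theorem prod_le_add (H : IsHyperbolicDist d o δ) (x x' y : X) :
    gromovProdFun d o x y ≤ gromovProdFun d o x' y + d x x' := by
  have h1 := H.triangle x x' o
  have h2 := H.triangle x' x y
  rw [H.comm x' x] at h2
  simp only [gromovProdFun]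
  linarith

theorem le_prod (H : IsHyperbolicDist d o δ) {x y z : X} {R : ℝ}
    (h1 : R + δ ≤ gromovProdFun d o x y) (h2 : R + δ ≤ gromovProdFun d o y z) :
    R ≤ gromovProdFun d o x z := by
  have := H.four_point x y z
  have := le_min h1 h2
  linarith

theorem tendsto_prod_trans (H : IsHyperbolicDist d o δ) {u v w : ℕ → X}
    (h1 : Tendsto (fun k => gromovProdFun d o (u k) (v k)) atTop atTop)
    (h2 : Tendsto (fun k => gromovProdFun d o (v k) (w k)) atTop atTop) :
    Tendsto (fun k => gromovProdFun d o (u k) (w k)) atTop atTop := by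
  rw [Filter.tendsto_atTop] at *
  intro R
  filter_upwards [h1 (R + δ), h2 (R + δ)] with k hk1 hk2 using H.le_prod hk1 hk2

end IsHyperbolicDist

theorem IsGromovSeq.tendsto_prod_self {u : ℕ → X} (hu : IsGromovSeq d o u) :
    Tendsto (fun k => gromovProdFun d o (u k) (u k)) atTop atTop := by
  rw [Filter.tendsto_atTop]
  intro R
  obtain ⟨N, hN⟩ := hu R
  filter_upwards [eventually_ge_atTop N] with k hk using hN k hk k hk

theorem exists_mem_gromovApproxSeqs_bd (ξ : GromovBdry d o) :
    ∃ u, u ∈ gromovApproxSeqs d o (GromovCl.bd d o ξ) := by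
  obtain ⟨⟨u, hu⟩, rfl⟩ := Quot.exists_rep ξ
  exact ⟨u, hu, rfl⟩

theorem IsGromovSeq.exists_mem_gromovApproxSeqs {u : ℕ → X} (hu : IsGromovSeq d o u) :
    ∃ ξ, u ∈ gromovApproxSeqs d o (GromovCl.bd d o ξ) :=
  ⟨Quot.mk _ ⟨u, hu⟩, hu, rfl⟩

theorem isGromovSeq_of_mem {ξ : GromovBdry d o} {u : ℕ → X}
    (hu : u ∈ gromovApproxSeqs d o (GromovCl.bd d o ξ)) : IsGromovSeq d o u := hu.1

theorem gromovBdry_eq_of_mem {ξ η : GromovBdry d o} {u : ℕ → X}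
    (hu : u ∈ gromovApproxSeqs d o (GromovCl.bd d o ξ))
    (hu' : u ∈ gromovApproxSeqs d o (GromovCl.bd d o η)) : ξ = η := by
  obtain ⟨h, rfl⟩ := hu
  obtain ⟨h', rfl⟩ := hu'
  rfl

theorem gromovBdry_eq_of_tendsto {ξ η : GromovBdry d o} {u v : ℕ → X}
    (hu : u ∈ gromovApproxSeqs d o (GromovCl.bd d o ξ))
    (hv : v ∈ gromovApproxSeqs d o (GromovCl.bd d o η))
    (h : Tendsto (fun k => gromovProdFun d o (u k) (v k)) atTop atTop) : ξ = η := by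
  obtain ⟨hu, rfl⟩ := hu
  obtain ⟨hv, rfl⟩ := hv
  exact Quot.sound h

namespace IsHyperbolicDist

theorem tendsto_prod_of_mem (H : IsHyperbolicDist d o δ) {ξ : GromovBdry d o} {u v : ℕ → X}
    (hu : u ∈ gromovApproxSeqs d o (GromovCl.bd d o ξ))
    (hv : v ∈ gromovApproxSeqs d o (GromovCl.bd d o ξ)) :
    Tendsto (fun k => gromovProdFun d o (u k) (v k)) atTop atTop := by
  obtain ⟨hu, rfl⟩ := hu
  obtain ⟨hv, h⟩ := hv
  have hgen := Quot.eqvGen_exact h.symm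
  have key : ∀ a b, Relation.EqvGen (GromovSeqRel d o) a b →
      Tendsto (fun k => gromovProdFun d o (a.1 k) (b.1 k)) atTop atTop := by
    intro a b hab
    induction hab with
    | rel _ _ h => exact h
    | refl a => exact a.2.tendsto_prod_self
    | symm _ _ _ h => simpa only [H.prod_comm] using h
    | trans _ _ _ _ _ h1 h2 => exact H.tendsto_prod_trans h1 h2
  exact key _ _ hgen

theorem mem_gromovApproxSeqs_of_forall_exists (H : IsHyperbolicDist d o δ) {ξ : GromovBdry d o}
    {u w : ℕ → X} (hu : u ∈ gromovApproxSeqs d o (GromovCl.bd d o ξ))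
    (h : ∀ R : ℝ, ∃ K, ∀ k ≥ K, ∃ j ≥ k, R ≤ gromovProdFun d o (w k) (u j)) :
    w ∈ gromovApproxSeqs d o (GromovCl.bd d o ξ) := by
  have hG := isGromovSeq_of_mem hu
  have hwu : ∀ R : ℝ, ∃ K, ∀ k ≥ K, R ≤ gromovProdFun d o (w k) (u k) := by
    intro R
    obtain ⟨K, hK⟩ := h (R + δ)
    obtain ⟨N, hN⟩ := hG (R + δ)
    refine ⟨max K N, fun k hk => ?_⟩
    obtain ⟨j, hj, hR⟩ := hK k ((le_max_left _ _).trans hk)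
    have hk' := (le_max_right _ _).trans hk
    exact H.le_prod hR (hN j (hk'.trans hj) k hk')
  have hw : IsGromovSeq d o w := by
    intro R
    obtain ⟨K, hK⟩ := hwu (R + δ + δ)
    obtain ⟨K', hK'⟩ := hwu (R + δ)
    obtain ⟨N, hN⟩ := hG (R + δ + δ)
    refine ⟨max (max K K') N, fun m hm n hn => ?_⟩
    simp only [ge_iff_le, max_le_iff] at hm hn
    refine H.le_prod (y := u n) (H.le_prod (hK m hm.1.1) (hN m hm.2 n hn.2)) ?_
    rw [H.prod_comm]
    exact hK' n hn.1.2
  obtain ⟨hu, rfl⟩ := hu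
  refine ⟨hw, Quot.sound ?_⟩
  simp only [GromovSeqRel, Filter.tendsto_atTop]
  intro R
  obtain ⟨K, hK⟩ := hwu R
  filter_upwards [eventually_ge_atTop K] with k hk using hK k hk

theorem comp_mem_gromovApproxSeqs (H : IsHyperbolicDist d o δ) {ξ : GromovBdry d o}
    {u : ℕ → X} (hu : u ∈ gromovApproxSeqs d o (GromovCl.bd d o ξ)) {φ : ℕ → ℕ}
    (hφ : StrictMono φ) : u ∘ φ ∈ gromovApproxSeqs d o (GromovCl.bd d o ξ) := by
  refine H.mem_gromovApproxSeqs_of_forall_exists hu fun R => ?_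
  obtain ⟨N, hN⟩ := isGromovSeq_of_mem hu R
  exact ⟨N, fun k hk => ⟨k, le_rfl, hN _ (hk.trans (hφ.id_le k)) k hk⟩⟩

end IsHyperbolicDist

theorem exists_frequently_prod_lt {a b : GromovCl d o} {R : ℝ} (h : extGromovProd d o a b < R) :
    ∃ u ∈ gromovApproxSeqs d o a, ∃ v ∈ gromovApproxSeqs d o b,
      ∃ᶠ k in atTop, gromovProdFun d o (u k) (v k) < R := by
  obtain ⟨_, ⟨u, hu, v, hv, rfl⟩, hlt⟩ := sInf_lt_iff.1 h
  refine ⟨u, hu, v, hv, (frequently_lt_of_liminf_lt (h := hlt)).mono fun k hk => ?_⟩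
  exact_mod_cast hk

theorem extGromovProd_le_of_frequently {a b : GromovCl d o} {R : ℝ} {u v : ℕ → X}
    (hu : u ∈ gromovApproxSeqs d o a) (hv : v ∈ gromovApproxSeqs d o b)
    (h : ∃ᶠ k in atTop, gromovProdFun d o (u k) (v k) ≤ R) : extGromovProd d o a b ≤ R :=
  sInf_le_of_le (b := liminf (fun k => ((gromovProdFun d o (u k) (v k) : ℝ) : EReal)) atTop)
    ⟨u, hu, v, hv, rfl⟩
    (liminf_le_of_frequently_le' (h.mono fun _ hk => EReal.coe_le_coe_iff.2 hk))

theorem EReal.le_coe_of_forall_lt_coe {x : EReal} {R : ℝ} (h : ∀ R' : ℝ, R < R' → x ≤ R') :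
    x ≤ R := by
  by_contra! hx
  obtain ⟨R', h1, h2⟩ := EReal.lt_iff_exists_real_btwn.1 hx
  exact absurd (h R' (by exact_mod_cast h1)) (not_le.2 h2)

/-- Choosing the approximating sequences relative to a reference sequence `v` of `ζ`. -/
theorem IsHyperbolicDist.exists_frequently_exists_prod_lt (H : IsHyperbolicDist d o δ)
    {a : GromovCl d o} {ζ : GromovBdry d o} {R : ℝ}
    (h : extGromovProd d o a (GromovCl.bd d o ζ) < R) {v : ℕ → X}
    (hv : v ∈ gromovApproxSeqs d o (GromovCl.bd d o ζ)) :
    ∃ u ∈ gromovApproxSeqs d o a, ∀ T : ℝ, ∃ᶠ j in atTop,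
      ∃ w, gromovProdFun d o (u j) w < R ∧ T ≤ gromovProdFun d o w (v j) := by
  obtain ⟨u, hu, w, hw, hf⟩ := exists_frequently_prod_lt h
  refine ⟨u, hu, fun T => ?_⟩
  have := (Filter.tendsto_atTop.1 (H.tendsto_prod_of_mem hw hv)) T
  exact (hf.and_eventually this).mono fun j hj => ⟨w j, hj⟩

/-- Lower semicontinuity of the extended Gromov product along sequences of the space. -/
theorem IsHyperbolicDist.extGromovProd_le_of_forall_exists (H : IsHyperbolicDist d o δ)
    {ξ ζ : GromovBdry d o} {R : ℝ} {x v : ℕ → X}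
    (hx : x ∈ gromovApproxSeqs d o (GromovCl.bd d o ξ))
    (hv : v ∈ gromovApproxSeqs d o (GromovCl.bd d o ζ))
    (h : ∀ k : ℕ, ∃ j ≥ k, ∃ w, gromovProdFun d o (x k) w ≤ R ∧
      (k : ℝ) ≤ gromovProdFun d o w (v j)) :
    extGromovProd d o (GromovCl.bd d o ξ) (GromovCl.bd d o ζ) ≤ R := by
  choose j hj w hw hwv using h
  refine extGromovProd_le_of_frequently (v := w) hx ?_ (Frequently.of_forall hw)
  refine H.mem_gromovApproxSeqs_of_forall_exists hv fun T => ⟨⌈T⌉₊, fun k hk => ⟨j k, hj k, ?_⟩⟩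
  exact ((Nat.le_ceil T).trans (by exact_mod_cast hk)).trans (hwv k)

theorem IsHyperbolicDist.tendsto_pt [TopologicalSpace X] (H : IsHyperbolicDist d o δ) {ξ : GromovBdry d o} {u : ℕ → X}
    (hu : u ∈ gromovApproxSeqs d o (GromovCl.bd d o ξ)) :
    Tendsto (fun k => GromovCl.pt d o (u k)) atTop
      (@nhds _ (gromovClTopology d o) (GromovCl.bd d o ξ)) := by
  rw [gromovClTopology, TopologicalSpace.tendsto_nhds_generateFrom_iff]
  rintro S (⟨U, -, rfl⟩ | ⟨ζ, R, rfl⟩) hS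
  · obtain ⟨x, -, hx⟩ := hS
    cases hx
  · by_contra hcon
    have hfreq : ∃ᶠ k in atTop,
        extGromovProd d o (GromovCl.pt d o (u k)) (GromovCl.bd d o ζ) ≤ R := by
      refine (not_eventually.1 hcon).mono fun k hk => ?_
      simpa using hk
    obtain ⟨φ, hφ, hle⟩ := extraction_of_frequently_atTop hfreq
    obtain ⟨v, hv⟩ := exists_mem_gromovApproxSeqs_bd ζ
    refine absurd (EReal.le_coe_of_forall_lt_coe fun R' hR' => ?_) (not_le.2 hS)
    refine H.extGromovProd_le_of_forall_exists (H.comp_mem_gromovApproxSeqs hu hφ) hv fun k => ?_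
    obtain ⟨u', hu', hf⟩ := H.exists_frequently_exists_prod_lt
      ((hle k).trans_lt (by exact_mod_cast hR' : (R : EReal) < R')) hv
    obtain ⟨j, hj, w, hw, hwv⟩ := (frequently_atTop.1 (hf k)) k
    obtain rfl : u' = fun _ => u (φ k) := hu'
    exact ⟨j, hj, w, hw.le, hwv⟩

theorem IsHyperbolicDist.extGromovProd_pt_le (H : IsHyperbolicDist d o δ) {x y : X}
    {ζ : GromovBdry d o} {R r : ℝ}
    (h : extGromovProd d o (GromovCl.pt d o x) (GromovCl.bd d o ζ) < R) (hr : d y x ≤ r) :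
    extGromovProd d o (GromovCl.pt d o y) (GromovCl.bd d o ζ) ≤ ↑(R + r) := by
  obtain ⟨u, hu, v, hv, hf⟩ := exists_frequently_prod_lt h
  obtain rfl : u = fun _ => x := hu
  refine extGromovProd_le_of_frequently (u := fun _ => y) rfl hv (hf.mono fun k hk => ?_)
  linarith [H.prod_le_add y x (v k)]

end GromovClosureLemmas
section GeodesicLimits

variable {X : Type*} {d : X → X → ℝ} {o : X} {δ : ℝ}

namespace IsHyperbolicDist

theorem abs_sub_le (H : IsHyperbolicDist d o δ) (x x' y y' : X) :
    |d x y - d x' y'| ≤ d x x' + d y y' := by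
  have h1 := H.triangle x x' y
  have h2 := H.triangle x' y' y
  have h3 := H.triangle x' x y'
  have h4 := H.triangle x y y'
  rw [H.comm y' y] at h2
  rw [H.comm x' x] at h3
  rw [abs_le]
  constructor <;> linarith

theorem tendsto_dist (H : IsHyperbolicDist d o δ) {ι : Type*} {l : Filter ι} {f g : ι → X}
    {x y : X} (hf : Tendsto (fun k => d (f k) x) l (𝓝 0))
    (hg : Tendsto (fun k => d (g k) y) l (𝓝 0)) :
    Tendsto (fun k => d (f k) (g k)) l (𝓝 (d x y)) := by
  rw [tendsto_iff_dist_tendsto_zero]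
  refine squeeze_zero (fun _ => dist_nonneg) (fun k => ?_) (by simpa using hf.add hg)
  exact H.abs_sub_le _ _ _ _

/-- An almost geodesic curve from `x` to `y`, parametrized by `[0, L]`. -/
theorem exists_almost_geodesic (H : IsHyperbolicDist d o δ) (P : IsProperLengthDist d o)
    (x y : X) {ε : ℝ} (hε : 0 < ε) :
    ∃ (L : ℝ) (f : ℝ → X), d x y ≤ L ∧ L ≤ d x y + ε ∧ f 0 = x ∧ f L = y ∧
      ∀ s ∈ Icc 0 L, ∀ t ∈ Icc 0 L, d (f s) (f t) ≤ |s - t| ∧ |s - t| - ε ≤ d (f s) (f t) := by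
  obtain ⟨L, f, hL0, hL, rfl, rfl, hf⟩ := P.length x y ε hε
  refine ⟨L, f, ?_, hL, rfl, rfl, fun s hs t ht => ⟨hf s hs t ht, ?_⟩⟩
  · simpa [abs_of_nonneg hL0] using hf 0 ⟨le_rfl, hL0⟩ L ⟨hL0, le_rfl⟩
  · wlog hst : s ≤ t generalizing s t
    · rw [abs_sub_comm, H.comm]
      exact this t ht s hs (le_of_not_ge hst)
    have h1 := hf 0 ⟨le_rfl, hL0⟩ s hs
    have h2 := hf t ht L ⟨hL0, le_rfl⟩
    rw [abs_of_nonpos (by linarith [hs.1])] at h1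
    rw [abs_of_nonpos (by linarith [ht.2])] at h2
    rw [abs_of_nonpos (by linarith)]
    have h3 := H.triangle (f 0) (f s) (f L)
    have h4 := H.triangle (f s) (f t) (f L)
    linarith

/-- Ultrafilter limits of almost geodesic curves are geodesics. -/
theorem exists_geodesic_limit (H : IsHyperbolicDist d o δ) (P : IsProperLengthDist d o)
    {𝒰 : Ultrafilter ℕ} (h𝒰 : (𝒰 : Filter ℕ) ≤ atTop) (f : ℕ → ℝ → X) (S : Set ℝ) (r : ℝ → ℝ)
    (hr : ∀ t ∈ S, ∀ᶠ k in 𝒰, d o (f k t) ≤ r t)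
    (hf : ∀ s ∈ S, ∀ t ∈ S, ∀ᶠ k in 𝒰, d (f k s) (f k t) ≤ |s - t| ∧
      |s - t| - 1 / ((k : ℝ) + 1) ≤ d (f k s) (f k t)) :
    ∃ g : ℝ → X, (∀ t ∈ S, Tendsto (fun k => d (f k t) (g t)) 𝒰 (𝓝 0)) ∧
      ∀ s ∈ S, ∀ t ∈ S, d (g s) (g t) = |s - t| := by
  have : ∀ t, ∃ y, t ∈ S → Tendsto (fun k => d (f k t) y) 𝒰 (𝓝 0) := by
    intro t
    by_cases ht : t ∈ S
    · obtain ⟨y, hy⟩ := P.proper _ 𝒰 (fun k => f k t) (hr t ht)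
      exact ⟨y, fun _ => hy⟩
    · exact ⟨o, fun h => absurd h ht⟩
  choose g hg using this
  refine ⟨g, hg, fun s hs t ht => ?_⟩
  refine tendsto_nhds_unique (H.tendsto_dist (hg s hs) (hg t ht)) ?_
  have h0 : Tendsto (fun k : ℕ => |s - t| - 1 / ((k : ℝ) + 1)) 𝒰 (𝓝 |s - t|) := by
    simpa using (tendsto_one_div_add_atTop_nhds_zero_nat (𝕜 := ℝ)).const_sub |s - t| |>.mono_left h𝒰
  exact tendsto_of_tendsto_of_tendsto_of_le_of_le' h0 tendsto_const_nhds
    ((hf s hs t ht).mono fun _ h => h.2) ((hf s hs t ht).mono fun _ h => h.1)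

/-- A geodesic ray defines a point of the Gromov boundary. -/
theorem exists_gromovBdry_of_ray (H : IsHyperbolicDist d o δ) {g : ℝ → X}
    (hg : ∀ s ≥ 0, ∀ t ≥ 0, d (g s) (g t) = |s - t|) :
    ∃ ξ : GromovBdry d o, ∀ t : ℕ → ℝ, Tendsto t atTop atTop →
      g ∘ t ∈ gromovApproxSeqs d o (GromovCl.bd d o ξ) := by
  have hprod : ∀ s ≥ 0, ∀ t ≥ 0, min s t - d (g 0) o ≤ gromovProdFun d o (g s) (g t) := by
    intro s hs t ht
    have h1 := H.triangle (g s) o (g 0)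
    have h2 := H.triangle (g t) o (g 0)
    rw [hg s hs 0 le_rfl, sub_zero, abs_of_nonneg hs, H.comm o (g 0)] at h1
    rw [hg t ht 0 le_rfl, sub_zero, abs_of_nonneg ht, H.comm o (g 0)] at h2
    simp only [gromovProdFun]
    rw [hg s hs t ht, H.comm o (g t)]
    rcases le_total s t with h | h
    · rw [min_eq_left h, abs_of_nonpos (by linarith)]; linarith
    · rw [min_eq_right h, abs_of_nonneg (by linarith)]; linarith
  have hG : IsGromovSeq d o fun k : ℕ => g k := by
    intro R
    refine ⟨⌈R + d (g 0) o⌉₊, fun m hm n hn => ?_⟩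
    have h1 : R + d (g 0) o ≤ m := (Nat.le_ceil _).trans (by exact_mod_cast hm)
    have h2 : R + d (g 0) o ≤ n := (Nat.le_ceil _).trans (by exact_mod_cast hn)
    linarith [hprod m m.cast_nonneg n n.cast_nonneg, le_min h1 h2]
  obtain ⟨ξ, hξ⟩ := hG.exists_mem_gromovApproxSeqs
  refine ⟨ξ, fun t ht => H.mem_gromovApproxSeqs_of_forall_exists hξ fun R => ?_⟩
  obtain ⟨K, hK⟩ := eventually_atTop.1
    ((ht.eventually_ge_atTop 0).and (ht.eventually_ge_atTop (R + d (g 0) o)))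
  refine ⟨K, fun k hk => ⟨max k ⌈t k⌉₊, le_max_left _ _, ?_⟩⟩
  have h1 : t k ≤ ((max k ⌈t k⌉₊ : ℕ) : ℝ) :=
    (Nat.le_ceil _).trans (by exact_mod_cast le_max_right _ _)
  have := hprod (t k) (hK k hk).1 _ (Nat.cast_nonneg (max k ⌈t k⌉₊))
  rw [min_eq_left h1] at this
  simp only [Function.comp]
  linarith [(hK k hk).2]

theorem mem_gromovApproxSeqs_of_limit (H : IsHyperbolicDist d o δ) {𝒰 : Ultrafilter ℕ}
    (h𝒰 : (𝒰 : Filter ℕ) ≤ atTop) {ξ : GromovBdry d o} {u : ℕ → X}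
    (hu : u ∈ gromovApproxSeqs d o (GromovCl.bd d o ξ)) {f : ℕ → ℝ → X} {g : ℝ → X} {C : ℝ}
    (hf : ∀ t ≥ 0, ∀ᶠ k in 𝒰, t - C ≤ gromovProdFun d o (f k t) (u k))
    (hg : ∀ t ≥ 0, Tendsto (fun k => d (f k t) (g t)) 𝒰 (𝓝 0)) :
    (fun k : ℕ => g k) ∈ gromovApproxSeqs d o (GromovCl.bd d o ξ) := by
  refine H.mem_gromovApproxSeqs_of_forall_exists hu fun R =>
    ⟨⌈R + C + 1⌉₊, fun k hk => ?_⟩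
  have hk' : R + C + 1 ≤ k := (Nat.le_ceil _).trans (by exact_mod_cast hk)
  obtain ⟨j, h1, h2, h3⟩ := ((hf k k.cast_nonneg).and (((hg k k.cast_nonneg).eventually
    (gt_mem_nhds zero_lt_one)).and (h𝒰 (eventually_ge_atTop k)))).exists
  exact ⟨j, h3, by linarith [H.prod_le_add (f j k) (g k) (u j)]⟩

/-- Sequential compactness at infinity. -/
theorem exists_subseq_isGromovSeq (H : IsHyperbolicDist d o δ) (P : IsProperLengthDist d o)
    {x : ℕ → X} (hx : Tendsto (fun k => d o (x k)) atTop atTop) :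
    ∃ φ : ℕ → ℕ, StrictMono φ ∧ IsGromovSeq d o (x ∘ φ) := by
  choose L f hL hLε hf0 hfL hf using fun k : ℕ =>
    H.exists_almost_geodesic P o (x k) (Nat.one_div_pos_of_nat (α := ℝ) (n := k))
  set 𝒰 : Ultrafilter ℕ := Ultrafilter.of atTop
  have h𝒰 : (𝒰 : Filter ℕ) ≤ atTop := Ultrafilter.of_le _
  have hLt : ∀ t, ∀ᶠ k in 𝒰, t ≤ L k := fun t =>
    h𝒰 ((hx.eventually_ge_atTop t).mono fun k hk => hk.trans (hL k))
  obtain ⟨g, hg, hgd⟩ := H.exists_geodesic_limit P h𝒰 f (Ici 0) id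
    (fun t ht => (hLt t).mono fun k hk => by
      have := (hf k 0 ⟨le_rfl, le_trans ht hk⟩ t ⟨ht, hk⟩).1
      rwa [hf0, zero_sub, abs_neg, abs_of_nonneg ht] at this)
    (fun s hs t ht => ((hLt s).and (hLt t)).mono fun k hk => hf k s ⟨hs, hk.1⟩ t ⟨ht, hk.2⟩)
  obtain ⟨ξ, hξ⟩ := H.exists_gromovBdry_of_ray hgd
  have hgξ := hξ _ tendsto_natCast_atTop_atTop
  have hfreq : ∀ i : ℕ, ∃ᶠ k in atTop, (i : ℝ) - 2 ≤ gromovProdFun d o (x k) (g i) := by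
    intro i
    refine Filter.Frequently.filter_mono (Eventually.frequently ?_) h𝒰
    have h0 : (0 : ℝ) ≤ i := i.cast_nonneg
    filter_upwards [hLt i, (hg i h0).eventually (gt_mem_nhds zero_lt_one)] with k hk h1
    have h2 := (hf k 0 ⟨le_rfl, h0.trans hk⟩ i ⟨h0, hk⟩).2
    have h3 := (hf k i ⟨h0, hk⟩ (L k) ⟨h0.trans hk, le_rfl⟩).1
    rw [hf0, zero_sub, abs_neg, abs_of_nonneg h0] at h2
    rw [hfL, abs_of_nonpos (by linarith)] at h3
    have h4 := hLε k
    have h5 : 1 / ((k : ℝ) + 1) ≤ 1 := by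
      rw [div_le_one (by positivity)]
      linarith [k.cast_nonneg (α := ℝ)]
    have h6 := H.prod_le_add (f k i) (g i) (x k)
    rw [H.prod_comm (x k)]
    have h7 : (i : ℝ) - 1 ≤ gromovProdFun d o (f k i) (x k) := by
      simp only [gromovProdFun]
      rw [H.comm (f k i) o]
      linarith
    linarith
  obtain ⟨φ, hφ, hle⟩ := extraction_forall_of_frequently hfreq
  refine ⟨φ, hφ, isGromovSeq_of_mem (H.mem_gromovApproxSeqs_of_forall_exists hgξ fun R => ?_)⟩
  refine ⟨⌈R + 2⌉₊, fun k hk => ⟨k, le_rfl, ?_⟩⟩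
  have hk' : R + 2 ≤ k := (Nat.le_ceil _).trans (by exact_mod_cast hk)
  simp only [Function.comp]
  linarith [hle k]

/-- Distinct points of the Gromov boundary are joined by a geodesic line. -/
theorem exists_line (H : IsHyperbolicDist d o δ) (P : IsProperLengthDist d o)
    {ξ η : GromovBdry d o} (hne : ξ ≠ η) :
    ∃ g : ℝ → X, (∀ s t, d (g s) (g t) = |s - t|) ∧
      (fun k : ℕ => g (-k)) ∈ gromovApproxSeqs d o (GromovCl.bd d o ξ) ∧
      (fun k : ℕ => g k) ∈ gromovApproxSeqs d o (GromovCl.bd d o η) := by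
  obtain ⟨u, hu⟩ := exists_mem_gromovApproxSeqs_bd ξ
  obtain ⟨v, hv⟩ := exists_mem_gromovApproxSeqs_bd η
  have hnt := mt (gromovBdry_eq_of_tendsto hu hv) hne
  obtain ⟨M, hM⟩ : ∃ M : ℝ, ∃ᶠ k in atTop, gromovProdFun d o (u k) (v k) < M := by
    by_contra! hcon
    refine hnt (Filter.tendsto_atTop.2 fun M => ?_)
    simpa using hcon M
  have : NeBot (atTop ⊓ 𝓟 {k | gromovProdFun d o (u k) (v k) < M}) :=
    frequently_mem_iff_neBot.1 hM
  set 𝒰 : Ultrafilter ℕ := Ultrafilter.of (atTop ⊓ 𝓟 {k | gromovProdFun d o (u k) (v k) < M})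
  have hle := Ultrafilter.of_le (atTop ⊓ 𝓟 {k | gromovProdFun d o (u k) (v k) < M})
  have h𝒰 : (𝒰 : Filter ℕ) ≤ atTop := hle.trans inf_le_left
  have h𝒰M : ∀ᶠ k in 𝒰, gromovProdFun d o (u k) (v k) < M :=
    (hle.trans inf_le_right) (mem_principal_self _)
  have hut : Tendsto (fun k => d o (u k)) 𝒰 atTop := by
    simpa only [H.prod_self] using (isGromovSeq_of_mem hu).tendsto_prod_self.mono_left h𝒰
  have hvt : Tendsto (fun k => d o (v k)) 𝒰 atTop := by
    simpa only [H.prod_self] using (isGromovSeq_of_mem hv).tendsto_prod_self.mono_left h𝒰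
  choose L f hL hLε hf0 hfL hf using fun k : ℕ =>
    H.exists_almost_geodesic P (u k) (v k) (Nat.one_div_pos_of_nat (α := ℝ) (n := k))
  have hε : ∀ k : ℕ, 1 / ((k : ℝ) + 1) ≤ 1 := fun k => by
    rw [div_le_one (by positivity)]
    linarith [k.cast_nonneg (α := ℝ)]
  set s : ℕ → ℝ := fun k => d o (u k) - gromovProdFun d o (u k) (v k) with hs
  have hsv : ∀ k, d (u k) (v k) - s k = d o (v k) - gromovProdFun d o (u k) (v k) := fun k => by
    simp only [hs, gromovProdFun]
    rw [H.comm (u k) o]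
    ring
  have hdom : ∀ t, ∀ᶠ k in 𝒰, s k + t ∈ Icc 0 (L k) := by
    intro t
    filter_upwards [h𝒰M, hut.eventually_ge_atTop (M - t), hvt.eventually_ge_atTop (M + t)]
      with k h1 h2 h3
    have := hsv k
    have := hL k
    constructor <;> simp only [hs] at * <;> linarith
  have h0L : ∀ k, (0 : ℝ) ∈ Icc 0 (L k) ∧ L k ∈ Icc 0 (L k) := fun k =>
    ⟨⟨le_rfl, (H.nonneg _ _).trans (hL k)⟩, (H.nonneg _ _).trans (hL k), le_rfl⟩
  have hleft : ∀ k t, s k + t ∈ Icc 0 (L k) → d (f k (s k + t)) (u k) ≤ s k + t := by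
    intro k t ht
    have := (hf k _ ht 0 (h0L k).1).1
    rwa [hf0, sub_zero, abs_of_nonneg ht.1] at this
  have hright : ∀ k t, s k + t ∈ Icc 0 (L k) → d (f k (s k + t)) (v k) ≤ L k - s k - t := by
    intro k t ht
    have := (hf k _ ht _ (h0L k).2).1
    rw [hfL, abs_of_nonpos (by linarith [ht.2])] at this
    linarith
  set C : ℝ := 2 * (M + δ) + 1
  have hC : ∀ᶠ k in 𝒰, d o (f k (s k + 0)) ≤ C := by
    filter_upwards [h𝒰M, hdom 0] with k h1 h2
    have h3 := H.four_point (u k) (f k (s k + 0)) (v k)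
    have hl := hleft k 0 h2
    have hr := hright k 0 h2
    have h4 : (d o (f k (s k + 0)) - 1) / 2 ≤
        gromovProdFun d o (u k) (f k (s k + 0)) := by
      have := H.prod_nonneg (u k) (v k)
      have : gromovProdFun d o (f k (s k + 0)) (u k) =
        (d (f k (s k + 0)) o + d o (u k) - d (f k (s k + 0)) (u k)) / 2 := rfl
      rw [H.prod_comm (u k), this, H.comm _ o]
      linarith
    have h5 : (d o (f k (s k + 0)) - 1) / 2 ≤
        gromovProdFun d o (f k (s k + 0)) (v k) := by
      have := H.prod_nonneg (u k) (v k)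
      have := hsv k
      have := hLε k
      have := hε k
      have : gromovProdFun d o (f k (s k + 0)) (v k) =
        (d (f k (s k + 0)) o + d o (v k) - d (f k (s k + 0)) (v k)) / 2 := rfl
      rw [this, H.comm _ o]
      linarith
    have := le_min h4 h5
    linarith
  have hd : ∀ a b, ∀ᶠ k in 𝒰, d (f k (s k + a)) (f k (s k + b)) ≤ |a - b| ∧
      |a - b| - 1 / ((k : ℝ) + 1) ≤ d (f k (s k + a)) (f k (s k + b)) := by
    intro a b
    filter_upwards [hdom a, hdom b] with k ha hb
    simpa using hf k _ ha _ hb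
  obtain ⟨g, hg, hgd⟩ := H.exists_geodesic_limit P h𝒰 (fun k t => f k (s k + t)) univ
    (fun t => C + |t|) (fun t _ => by
      filter_upwards [hC, hd 0 t] with k h1 h2
      rw [zero_sub, abs_neg] at h2
      linarith [H.triangle o (f k (s k + 0)) (f k (s k + t))])
    (fun a _ b _ => hd a b)
  have hfar : ∀ t, ∀ᶠ k in 𝒰, |t| - 1 - C ≤ d o (f k (s k + t)) := by
    intro t
    filter_upwards [hC, hd 0 t] with k h1 h2
    rw [zero_sub, abs_neg] at h2
    have h3 := H.triangle (f k (s k + 0)) o (f k (s k + t))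
    rw [H.comm _ o] at h3
    linarith [hε k]
  refine ⟨g, fun a b => hgd a trivial b trivial, ?_, ?_⟩
  · refine H.mem_gromovApproxSeqs_of_limit h𝒰 hu (f := fun k t => f k (s k + -t))
      (g := fun t => g (-t)) (C := (1 + C) / 2) (fun t ht => ?_) fun t _ => hg (-t) trivial
    filter_upwards [hdom (-t), hfar (-t)] with k h1 h2
    have hl := hleft k _ h1
    have := H.prod_nonneg (u k) (v k)
    rw [abs_neg, abs_of_nonneg ht] at h2
    have : gromovProdFun d o (f k (s k + -t)) (u k) =
        (d (f k (s k + -t)) o + d o (u k) - d (f k (s k + -t)) (u k)) / 2 := rfl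
    rw [this, H.comm _ o]
    linarith
  · refine H.mem_gromovApproxSeqs_of_limit h𝒰 hv (f := fun k t => f k (s k + t))
      (g := g) (C := (2 + C) / 2) (fun t ht => ?_) fun t _ => hg t trivial
    filter_upwards [hdom t, hfar t] with k h1 h2
    have hr := hright k _ h1
    have := H.prod_nonneg (u k) (v k)
    have := hsv k
    have := hLε k
    have := hε k
    rw [abs_of_nonneg ht] at h2
    have : gromovProdFun d o (f k (s k + t)) (v k) =
        (d (f k (s k + t)) o + d o (v k) - d (f k (s k + t)) (v k)) / 2 := rfl
    rw [this, H.comm _ o]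
    linarith

end IsHyperbolicDist

end GeodesicLimits
section QHDistance

variable {Ω : Set E}

theorem qhDist_of_compl_eq_empty (h : Ωᶜ = ∅) (x y : E) : qhDist Ω x y = 0 := by
  refine le_antisymm (Real.sInf_nonpos ?_) (qhDist_nonneg x y)
  rintro _ ⟨γ, a, b, -, rfl⟩
  simp [qhLength, h]

theorem isHyperbolicDist_qhSubDist [CompleteSpace E] (hO : IsOpen Ω) (hC : IsPreconnected Ω)
    (hG : QHGromovHyperbolic Ω) (o : Ω) : ∃ δ, IsHyperbolicDist (qhSubDist Ω) o δ := by
  obtain ⟨δ, -, hδ⟩ := hG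
  refine ⟨δ, fun x => qhDist_self x.2, fun x y => qhDist_comm _ _, fun x y z => ?_,
    fun x y z => hδ o o.2 x x.2 y y.2 z z.2⟩
  rcases Ωᶜ.eq_empty_or_nonempty with h | h
  · simp [qhSubDist, qhDist_of_compl_eq_empty h]
  · exact qhDist_triangle hO h hC x.2 y.2 z.2

theorem tendsto_qhSubDist_nhds (hO : IsOpen Ω) (x : Ω) :
    Tendsto (fun y => qhSubDist Ω x y) (𝓝 x) (𝓝 0) := by
  rcases Ωᶜ.eq_empty_or_nonempty with h | h
  · simp [qhSubDist, qhDist_of_compl_eq_empty h]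
  · exact (tendsto_qhDist_nhds hO h x.2).comp continuous_subtype_val.continuousAt

/-- Quasihyperbolic balls of a bounded domain are relatively compact. -/
theorem exists_isCompact_of_qhDist_le [FiniteDimensional ℝ E] (hO : IsOpen Ω)
    (hC : IsPreconnected Ω) (hB : Bornology.IsBounded Ω) (o : Ω) (r : ℝ) :
    ∃ K : Set E, IsCompact K ∧ K ⊆ Ω ∧ ∀ x ∈ Ω, qhDist Ω o x ≤ r → x ∈ K := by
  have : CompleteSpace E := FiniteDimensional.complete ℝ E
  have : ProperSpace E := FiniteDimensional.proper ℝ E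
  rcases Ωᶜ.eq_empty_or_nonempty with h | h
  · have hu : Ω = univ := compl_empty_iff.1 h
    refine ⟨Ω, ?_, subset_rfl, fun x hx _ => hx⟩
    exact isCompact_of_isClosed_isBounded (hu ▸ isClosed_univ) hB
  · set m := Real.exp (Real.log (infDist (o : E) Ωᶜ) - r)
    have hm : 0 < m := Real.exp_pos _
    refine ⟨closure Ω ∩ {x | m ≤ infDist x Ωᶜ}, ?_, ?_, ?_⟩
    · exact hB.isCompact_closure.inter_right (isClosed_le continuous_const
        (continuous_infDist_pt _))
    · rintro x ⟨-, hx⟩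
      by_contra hxΩ
      rw [mem_ofPred_eq, infDist_zero_of_mem (show x ∈ Ωᶜ from hxΩ)] at hx
      exact absurd hx (not_le.2 hm)
    · intro x hx hr
      refine ⟨subset_closure hx, ?_⟩
      have hpos := infDist_compl_pos hO h hx
      rw [mem_ofPred_eq, ← Real.le_log_iff_exp_le hpos]
      refine le_of_forall_pos_le_add fun ε hε => ?_
      obtain ⟨γ, a, b, hγ, hlt⟩ := exists_qhLength_lt hO h hC o.2 hx hε
      linarith [log_infDist_sub_le_qhLength hO h hγ]

theorem isProperLengthDist_qhSubDist [FiniteDimensional ℝ E] (hO : IsOpen Ω)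
    (hC : IsPreconnected Ω) (hB : Bornology.IsBounded Ω) (o : Ω) :
    IsProperLengthDist (qhSubDist Ω) o := by
  have : CompleteSpace E := FiniteDimensional.complete ℝ E
  constructor
  · intro r 𝒰 f hf
    obtain ⟨K, hK, hKΩ, hr⟩ := exists_isCompact_of_qhDist_le hO hC hB o r
    obtain ⟨y, hy, hlim⟩ := hK.ultrafilter_le_nhds (𝒰.map fun k => (f k : E)) (by
      rw [le_principal_iff]
      exact hf.mono fun k hk => hr _ (f k).2 hk)
    refine ⟨⟨y, hKΩ hy⟩, ?_⟩
    have hfy : Tendsto f 𝒰 (𝓝 ⟨y, hKΩ hy⟩) := tendsto_subtype_rng.2 hlim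
    simpa only [qhSubDist, qhDist_comm, Function.comp_def] using
      (tendsto_qhSubDist_nhds hO _).comp hfy
  · intro x y ε hε
    rcases Ωᶜ.eq_empty_or_nonempty with h | h
    · classical
      refine ⟨ε, fun t => if t = 0 then x else y, hε.le, ?_, by simp, by simp [hε.ne'], ?_⟩
      all_goals simp [qhSubDist, qhDist_of_compl_eq_empty h]
    · obtain ⟨γ, a, b, hγ, hlt⟩ := exists_qhLength_lt hO h hC x.2 y.2 (half_pos hε)
      have hab := hγ.1
      have hi := hγ.intervalIntegrable hO h
      have hsub : ∀ s t, a ≤ s → s ≤ t → t ≤ b →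
          qhLength Ω γ a t - qhLength Ω γ a s = qhLength Ω γ s t := by
        intro s t has hst htb
        refine intervalIntegral.integral_interval_sub_left (hi.mono_set ?_) (hi.mono_set ?_)
        all_goals
          rw [uIcc_of_le hab, uIcc_of_le (by linarith)]
          exact Icc_subset_Icc le_rfl (by linarith)
      have hcont : ContinuousOn (fun t => qhLength Ω γ a t) (Icc a b) := by
        have := intervalIntegral.continuousOn_primitive_interval (μ := volume)
          (f := fun t => ‖deriv γ t‖ / infDist (γ t) Ωᶜ) (a := a) (b := b)
          (by rw [uIcc_of_le hab, integrableOn_Icc_iff_integrableOn_Ioc]; exact hi.1)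
        rwa [uIcc_of_le hab] at this
      have hz : qhLength Ω γ a a = 0 := intervalIntegral.integral_same
      have hex : ∀ s ∈ Icc 0 (qhLength Ω γ a b), ∃ t ∈ Icc a b, qhLength Ω γ a t = s := by
        have := intermediate_value_Icc hab hcont
        rw [hz] at this
        exact fun s hs => this hs
      have hτ : ∀ s, ∃ t ∈ Icc a b, s ∈ Icc 0 (qhLength Ω γ a b + ε / 2) →
          qhLength Ω γ a t = min s (qhLength Ω γ a b) ∧ (s = 0 → t = a) ∧
            (s = qhLength Ω γ a b + ε / 2 → t = b) := by
        intro s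
        have hL := qhLength_nonneg (Ω := Ω) (γ := γ) hab
        by_cases hs : s ∈ Icc 0 (qhLength Ω γ a b + ε / 2)
        · by_cases h0 : s = 0
          · refine ⟨a, ⟨le_rfl, hab⟩, fun _ => ⟨?_, fun _ => rfl, fun h => ?_⟩⟩
            · rw [hz, h0, min_eq_left hL]
            · linarith
          · by_cases h1 : s = qhLength Ω γ a b + ε / 2
            · exact ⟨b, ⟨hab, le_rfl⟩, fun _ => ⟨by rw [min_eq_right (by linarith)],
                fun h => absurd h h0, fun _ => rfl⟩⟩
            · obtain ⟨t, ht, hts⟩ := hex (min s (qhLength Ω γ a b))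
                ⟨le_min hs.1 hL, min_le_right _ _⟩
              exact ⟨t, ht, fun _ => ⟨hts, fun h => absurd h h0, fun h => absurd h h1⟩⟩
        · exact ⟨a, ⟨le_rfl, hab⟩, fun h => absurd h hs⟩
      choose τ hτI hτ using hτ
      have hd : ∀ s ∈ Icc a b, ∀ t ∈ Icc a b,
          qhDist Ω (γ s) (γ t) ≤ |qhLength Ω γ a s - qhLength Ω γ a t| := by
        have key : ∀ s ∈ Icc a b, ∀ t ∈ Icc a b, s ≤ t →
            qhDist Ω (γ s) (γ t) ≤ |qhLength Ω γ a s - qhLength Ω γ a t| := by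
          intro s hs t ht hst
          rw [abs_sub_comm]
          refine le_trans ?_ (le_abs_self _)
          rw [hsub s t hs.1 hst ht.2]
          exact qhDist_le_qhLength (hγ.mono hs.1 hst ht.2)
        intro s hs t ht
        rcases le_total s t with hst | hst
        · exact key s hs t ht hst
        · rw [qhDist_comm, abs_sub_comm]
          exact key t ht s hs hst
      have hL := qhLength_nonneg (Ω := Ω) (γ := γ) hab
      refine ⟨qhLength Ω γ a b + ε / 2, fun s => ⟨γ (τ s), hγ.2.2.2.1 _ (hτI s)⟩, by linarith,
        ?_, ?_, ?_, fun s hs t ht => ?_⟩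
      · show _ ≤ qhDist Ω x y + ε
        linarith
      · exact Subtype.ext ((congrArg γ ((hτ 0 ⟨le_rfl, by linarith⟩).2.1 rfl)).trans hγ.2.1)
      · exact Subtype.ext ((congrArg γ ((hτ _ ⟨by linarith, le_rfl⟩).2.2 rfl)).trans hγ.2.2.1)
      · refine (hd _ (hτI s) _ (hτI t)).trans ?_
        rw [(hτ s hs).1, (hτ t ht).1]
        simpa using abs_min_sub_min_le_max s (qhLength Ω γ a b) t (qhLength Ω γ a b)

end QHDistance
section Extension

variable {Ω : Set E} {o : Ω} {δ : ℝ} {Φ : QHGromovClosure Ω o → E}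

theorem tendsto_qhSubDist_atTop [FiniteDimensional ℝ E] (hO : IsOpen Ω) (hC : IsPreconnected Ω)
    (hB : Bornology.IsBounded Ω) (o : Ω) {x : ℕ → Ω} {p : E} (hp : p ∉ Ω)
    (hx : Tendsto (fun k => (x k : E)) atTop (𝓝 p)) :
    Tendsto (fun k => qhSubDist Ω o (x k)) atTop atTop := by
  refine Filter.tendsto_atTop.2 fun r => ?_
  obtain ⟨K, hK, hKΩ, hr⟩ := exists_isCompact_of_qhDist_le hO hC hB o r
  filter_upwards [hx (hK.isClosed.isOpen_compl.mem_nhds fun h => hp (hKΩ h))] with k hk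
  exact le_of_not_ge fun h => hk (hr _ (x k).2 h)

theorem tendsto_extension (H : IsHyperbolicDist (qhSubDist Ω) o δ) (hΦ : Continuous Φ)
    (hid : ∀ x : Ω, Φ (qhClPt Ω o x) = x) {a : QHGromovClosure Ω o} {u : ℕ → Ω}
    (hu : u ∈ gromovApproxSeqs (qhSubDist Ω) o a) :
    Tendsto (fun k => (u k : E)) atTop (𝓝 (Φ a)) := by
  rcases a with x | ξ
  · obtain rfl : u = fun _ => x := hu
    rw [show Φ (Sum.inl x) = x from hid x]
    exact tendsto_const_nhds
  · have h : Tendsto (fun k => qhClPt Ω o (u k)) atTop (𝓝 (Sum.inr ξ : QHGromovClosure Ω o)) :=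
      H.tendsto_pt hu
    simpa only [Function.comp_def, hid] using (hΦ.tendsto _).comp h

theorem extension_bd_notMem (H : IsHyperbolicDist (qhSubDist Ω) o δ) (hO : IsOpen Ω)
    (hΦ : Continuous Φ) (hid : ∀ x : Ω, Φ (qhClPt Ω o x) = x)
    (ξ : GromovBdry (qhSubDist Ω) o) : Φ (GromovCl.bd (qhSubDist Ω) o ξ) ∉ Ω := by
  intro hy
  obtain ⟨u, hu⟩ := exists_mem_gromovApproxSeqs_bd ξ
  have hlim : Tendsto u atTop (𝓝 ⟨_, hy⟩) := tendsto_subtype_rng.2 (tendsto_extension H hΦ hid hu)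
  have h0 := (tendsto_qhSubDist_nhds hO _).comp hlim
  have h1 := (isGromovSeq_of_mem hu).tendsto_prod_self
  obtain ⟨k, hk0, hk1⟩ := ((h0.eventually (gt_mem_nhds one_pos)).and
    (h1.eventually_ge_atTop (qhSubDist Ω o ⟨_, hy⟩ + 1))).exists
  rw [H.prod_self] at hk1
  have := H.triangle o ⟨_, hy⟩ (u k)
  simp only [Function.comp_apply] at hk0
  linarith

theorem exists_tendsto_extension_of_ray (H : IsHyperbolicDist (qhSubDist Ω) o δ)
    (hΦ : Continuous Φ) (hid : ∀ x : Ω, Φ (qhClPt Ω o x) = x) {g : ℝ → Ω}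
    (hg : ∀ s ≥ 0, ∀ t ≥ 0, qhSubDist Ω (g s) (g t) = |s - t|) :
    ∃ ξ, (fun k : ℕ => g k) ∈ gromovApproxSeqs (qhSubDist Ω) o (GromovCl.bd _ o ξ) ∧
      Tendsto (fun t => (g t : E)) atTop (𝓝 (Φ (GromovCl.bd (qhSubDist Ω) o ξ))) := by
  obtain ⟨ξ, hξ⟩ := H.exists_gromovBdry_of_ray hg
  exact ⟨ξ, hξ _ tendsto_natCast_atTop_atTop,
    tendsto_of_seq_tendsto fun t ht => tendsto_extension H hΦ hid (hξ t ht)⟩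

theorem setOf_mapClusterPt_eq_singleton {α Y : Type*} [TopologicalSpace Y] [T2Space Y]
    {l : Filter α} [l.NeBot] {f : α → Y} {y : Y} (h : Tendsto f l (𝓝 y)) :
    {x | MapClusterPt x l f} = {y} := by
  ext x
  refine ⟨fun hx => ?_, fun hx => ?_⟩
  · have hx' : ClusterPt x (𝓝 y) := ClusterPt.mono (show ClusterPt x (map f l) from hx) h
    have : (𝓝 x ⊓ 𝓝 y).NeBot := hx'
    exact eq_of_nhds_neBot this
  · obtain rfl : x = y := hx
    exact h.mapClusterPt

theorem exists_endpoints_of_line (H : IsHyperbolicDist (qhSubDist Ω) o δ)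
    (hΦ : Continuous Φ) (hid : ∀ x : Ω, Φ (qhClPt Ω o x) = x) {g : ℝ → Ω}
    (hg : ∀ s t, qhSubDist Ω (g s) (g t) = |s - t|) :
    ∃ ξ η, (fun k : ℕ => g (-k)) ∈ gromovApproxSeqs (qhSubDist Ω) o (GromovCl.bd _ o ξ) ∧
      (fun k : ℕ => g k) ∈ gromovApproxSeqs (qhSubDist Ω) o (GromovCl.bd _ o η) ∧
      {x : E | MapClusterPt x atBot fun t => (g t : E)} =
        {Φ (GromovCl.bd (qhSubDist Ω) o ξ)} ∧
      {x : E | MapClusterPt x atTop fun t => (g t : E)} =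
        {Φ (GromovCl.bd (qhSubDist Ω) o η)} := by
  obtain ⟨η, hη, hη'⟩ := exists_tendsto_extension_of_ray H hΦ hid fun s _ t _ => hg s t
  obtain ⟨ξ, hξ, hξ'⟩ := exists_tendsto_extension_of_ray (g := fun t => g (-t)) H hΦ hid
    fun s _ t _ => by rw [hg, ← abs_neg]; congr 1; ring
  refine ⟨ξ, η, hξ, hη, setOf_mapClusterPt_eq_singleton ?_, setOf_mapClusterPt_eq_singleton hη'⟩
  simpa [Function.comp_def] using hξ'.comp tendsto_neg_atBot_atTop

theorem noGeodesicLoop_of_injective (H : IsHyperbolicDist (qhSubDist Ω) o δ)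
    (hΦ : Continuous Φ) (hid : ∀ x : Ω, Φ (qhClPt Ω o x) = x) (hinj : Function.Injective Φ) :
    NoGeodesicLoop Ω := by
  rintro γ ⟨hγΩ, hγ⟩ heq
  set g : ℝ → Ω := fun t => ⟨γ t, hγΩ t trivial⟩
  obtain ⟨ξ, η, hξ, hη, hbot, htop⟩ := exists_endpoints_of_line (g := g) H hΦ hid
    fun s t => hγ s trivial t trivial
  have : ξ = η := Sum.inr.inj (hinj (singleton_eq_singleton_iff.1 (hbot.symm.trans
    (heq.symm.trans htop))))
  subst this
  obtain ⟨k, hk⟩ := ((H.tendsto_prod_of_mem hξ hη).eventually_gt_atTop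
    (qhSubDist Ω (g 0) o)).exists
  have h1 : qhSubDist Ω (g (-k)) (g k) = |(-k : ℝ) - k| := hγ _ trivial _ trivial
  have h2 : qhSubDist Ω (g (-k)) (g 0) = |(-k : ℝ) - 0| := hγ _ trivial _ trivial
  have h3 : qhSubDist Ω (g 0) (g k) = |(0 : ℝ) - k| := hγ _ trivial _ trivial
  have hk0 : (0 : ℝ) ≤ k := k.cast_nonneg
  rw [abs_of_nonpos (by linarith)] at h1 h2 h3
  have t1 := H.triangle (g (-k)) (g 0) o
  have t2 := H.triangle o (g 0) (g k)
  have c := H.comm o (g 0)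
  unfold gromovProdFun at hk
  linarith

theorem injective_of_noGeodesicLoop (H : IsHyperbolicDist (qhSubDist Ω) o δ)
    (P : IsProperLengthDist (qhSubDist Ω) o) (hO : IsOpen Ω)
    (hΦ : Continuous Φ) (hid : ∀ x : Ω, Φ (qhClPt Ω o x) = x) (hL : NoGeodesicLoop Ω) :
    Function.Injective Φ := by
  rintro (x | ξ) (y | η) h
  · have : (x : E) = y := (hid x).symm.trans (h.trans (hid y))
    rw [Subtype.ext this]
  · exact absurd (h ▸ (hid x).symm ▸ x.2 : Φ (Sum.inr η) ∈ Ω) (extension_bd_notMem H hO hΦ hid η)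
  · exact absurd (h ▸ (hid y).symm ▸ y.2 : Φ (Sum.inr ξ) ∈ Ω) (extension_bd_notMem H hO hΦ hid ξ)
  · by_contra hne
    obtain ⟨g, hg, hξ, hη⟩ := H.exists_line P fun h : ξ = η => hne (congrArg _ h)
    obtain ⟨ξ', η', hξ', hη', hbot, htop⟩ := exists_endpoints_of_line H hΦ hid hg
    obtain rfl := gromovBdry_eq_of_mem hξ hξ'
    obtain rfl := gromovBdry_eq_of_mem hη hη'
    refine hL (fun t => g t) ⟨fun t _ => (g t).2, fun s _ t _ => hg s t⟩ ?_
    rw [hbot, htop]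
    exact congrArg _ h.symm

/-- Injectivity of the extension makes the basic neighbourhoods of boundary points open for the
Euclidean topology. -/
theorem extGromovProd_le_of_tendsto [FiniteDimensional ℝ E]
    (H : IsHyperbolicDist (qhSubDist Ω) o δ) (P : IsProperLengthDist (qhSubDist Ω) o)
    (hO : IsOpen Ω) (hC : IsPreconnected Ω) (hB : Bornology.IsBounded Ω)
    (hΦ : Continuous Φ) (hid : ∀ x : Ω, Φ (qhClPt Ω o x) = x) (hinj : Function.Injective Φ)
    {a : ℕ → QHGromovClosure Ω o} {b : QHGromovClosure Ω o}
    (hab : Tendsto (fun k => Φ (a k)) atTop (𝓝 (Φ b))) {ζ : GromovBdry (qhSubDist Ω) o} {R : ℝ}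
    (ha : ∀ k, extGromovProd (qhSubDist Ω) o (a k) (GromovCl.bd _ o ζ) ≤ R) :
    extGromovProd (qhSubDist Ω) o b (GromovCl.bd _ o ζ) ≤ R := by
  refine EReal.le_coe_of_forall_lt_coe fun R' hR' => ?_
  rcases b with x | ξ
  · have hx : Φ (Sum.inl x) = x := hid x
    rw [hx] at hab
    set r := (R' - R) / 2
    have hr : 0 < r := half_pos (sub_pos.2 hR')
    have hnear : ∀ᶠ z : E in 𝓝 x, ∃ y : Ω, (y : E) = z ∧ qhSubDist Ω x y < r := by
      have := (tendsto_qhSubDist_nhds hO x).eventually (gt_mem_nhds hr)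
      rw [nhds_subtype_eq_comap, eventually_comap] at this
      filter_upwards [this, hO.mem_nhds x.2] with z hz hzΩ
      exact ⟨⟨z, hzΩ⟩, rfl, hz _ rfl⟩
    obtain ⟨k, y, hy, hyr⟩ := (hab.eventually hnear).exists
    have hak : a k = qhClPt Ω o y := hinj (hy.symm.trans (hid y).symm)
    have h1 := ha k
    rw [hak] at h1
    have h2 := H.extGromovProd_pt_le (x := y) (y := x) (R := R + r)
      (lt_of_le_of_lt h1 (EReal.coe_lt_coe_iff.2 (by linarith))) hyr.le
    refine h2.trans (EReal.coe_le_coe_iff.2 ?_)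
    simp only [r]
    linarith
  · obtain ⟨v, hv⟩ := exists_mem_gromovApproxSeqs_bd ζ
    have hex : ∀ k : ℕ, ∃ x : Ω, dist (x : E) (Φ (a k)) < 1 / ((k : ℝ) + 1) ∧ ∃ j ≥ k, ∃ w,
        gromovProdFun (qhSubDist Ω) o x w ≤ R' ∧
          (k : ℝ) ≤ gromovProdFun (qhSubDist Ω) o w (v j) := by
      intro k
      obtain ⟨u, hu, huv⟩ := H.exists_frequently_exists_prod_lt
        ((ha k).trans_lt (EReal.coe_lt_coe_iff.2 hR')) hv
      have hlim := (tendsto_extension H hΦ hid hu).eventually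
        (ball_mem_nhds _ (Nat.one_div_pos_of_nat (n := k) (α := ℝ)))
      obtain ⟨j, ⟨w, hw, hwv⟩, hj, hjk⟩ :=
        ((huv k).and_eventually (hlim.and (eventually_ge_atTop k))).exists
      exact ⟨u j, hj, j, hjk, w, hw.le, hwv⟩
    choose x hxd hx using hex
    have hxlim : Tendsto (fun k => (x k : E)) atTop (𝓝 (Φ (Sum.inr ξ))) := by
      refine (tendsto_iff_of_dist ?_).2 hab
      exact squeeze_zero (fun _ => dist_nonneg) (fun k => (hxd k).le)
        tendsto_one_div_add_atTop_nhds_zero_nat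
    obtain ⟨φ, hφ, hG⟩ := H.exists_subseq_isGromovSeq P
      (tendsto_qhSubDist_atTop hO hC hB o (extension_bd_notMem H hO hΦ hid ξ) hxlim)
    obtain ⟨ξ', hξ'⟩ := hG.exists_mem_gromovApproxSeqs
    have : ξ' = ξ := Sum.inr.inj (hinj (tendsto_nhds_unique (tendsto_extension H hΦ hid hξ')
      (hxlim.comp hφ.tendsto_atTop)))
    subst this
    refine H.extGromovProd_le_of_forall_exists hξ' hv fun k => ?_
    obtain ⟨j, hj, w, hw, hwv⟩ := hx (φ k)
    exact ⟨j, (hφ.id_le k).trans hj, w, hw,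
      (Nat.cast_le.2 (hφ.id_le k)).trans hwv⟩

theorem exists_homeomorph_of_injective [FiniteDimensional ℝ E]
    (H : IsHyperbolicDist (qhSubDist Ω) o δ) (P : IsProperLengthDist (qhSubDist Ω) o)
    (hO : IsOpen Ω) (hC : IsPreconnected Ω) (hB : Bornology.IsBounded Ω)
    (hΦ : Continuous Φ) (hid : ∀ x : Ω, Φ (qhClPt Ω o x) = x) (hinj : Function.Injective Φ)
    (hrange : range Φ = closure Ω) :
    ∃ Ψ : QHGromovClosure Ω o ≃ₜ closure Ω, ∀ a, (Ψ a : E) = Φ a := by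
  let f : QHGromovClosure Ω o → closure Ω := fun a => ⟨Φ a, hrange.subset (mem_range_self a)⟩
  have hf : Function.Bijective f := by
    refine ⟨fun a b h => hinj (congrArg Subtype.val h), fun y => ?_⟩
    obtain ⟨a, ha⟩ : (y : E) ∈ range Φ := hrange.superset y.2
    exact ⟨a, Subtype.ext ha⟩
  let e := Equiv.ofBijective f hf
  have he : ∀ y : closure Ω, Φ (e.symm y) = y := fun y =>
    congrArg Subtype.val (Equiv.ofBijective_apply_symm_apply f hf y)
  refine ⟨⟨e, hΦ.subtype_mk _, ?_⟩, fun a => rfl⟩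
  refine continuous_generateFrom_iff.2 ?_
  rintro S (⟨U, hU, rfl⟩ | ⟨ζ, R, rfl⟩)
  · have : e.symm ⁻¹' (GromovCl.pt (qhSubDist Ω) o '' U) =
        ((↑) : closure Ω → E) ⁻¹' ((↑) '' U) := by
      ext y
      constructor
      · rintro ⟨x, hx, hxy⟩
        refine ⟨x, hx, ?_⟩
        rw [← he y, ← hid x]
        exact congrArg Φ hxy
      · rintro ⟨x, hx, hxy⟩
        refine ⟨x, hx, hinj ?_⟩
        rw [he y, ← hxy]
        exact hid x
    change IsOpen (e.symm ⁻¹' (GromovCl.pt (qhSubDist Ω) o '' U))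
    rw [this]
    exact (hO.isOpenMap_subtype_val U hU).preimage continuous_subtype_val
  · rw [← isClosed_compl_iff]
    refine IsSeqClosed.isClosed fun y z hy hyz => ?_
    change ¬ (R : EReal) < extGromovProd (qhSubDist Ω) o (e.symm z) (GromovCl.bd _ o ζ)
    refine not_lt.2 (extGromovProd_le_of_tendsto (a := fun k => e.symm (y k)) H P hO hC hB hΦ hid hinj ?_
      fun k => not_lt.1 (hy k))
    simp only [he]
    exact (continuous_subtype_val.tendsto z).comp hyz

end Extension

/-- Let `Ω ⊆ ℝⁿ` be a bounded QH-visibility domain with `(Ω, k_Ω)` Gromov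
hyperbolic and let `Φ` be the continuous surjective extension of the identity map from the
Gromov closure onto the Euclidean closure. Then `Φ` is a homeomorphism if and only if `Ω`
has no geodesic loop in the Euclidean closure. -/
theorem statement2 {n : ℕ} (Ω : Set (EuclideanSpace ℝ (Fin n)))
    (hOpen : IsOpen Ω) (hConn : IsConnected Ω) (hBdd : Bornology.IsBounded Ω)
    (hGromov : QHGromovHyperbolic Ω) (hVis : QHVisibilityDomain Ω) (o : ↥Ω)
    (Φ : QHGromovClosure Ω o → EuclideanSpace ℝ (Fin n))
    (hΦcont : Continuous Φ)
    (hΦid : ∀ x : ↥Ω, Φ (qhClPt Ω o x) = (x : EuclideanSpace ℝ (Fin n)))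
    (hΦsurj : Set.range Φ = closure Ω) :
    (∃ Ψ : QHGromovClosure Ω o ≃ₜ ↥(closure Ω),
        ∀ a : QHGromovClosure Ω o, (↑(Ψ a) : EuclideanSpace ℝ (Fin n)) = Φ a) ↔
      NoGeodesicLoop Ω := by
  have hC := hConn.isPreconnected
  obtain ⟨δ, H⟩ := isHyperbolicDist_qhSubDist hOpen hC hGromov o
  have P := isProperLengthDist_qhSubDist hOpen hC hBdd o
  constructor
  · rintro ⟨Ψ, hΨ⟩
    refine noGeodesicLoop_of_injective H hΦcont hΦid fun a b hab => Ψ.injective (Subtype.ext ?_)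
    rw [hΨ, hΨ, hab]
  · intro hL
    exact exists_homeomorph_of_injective H P hOpen hC hBdd hΦcont hΦid
      (injective_of_noGeodesicLoop H P hOpen hΦcont hΦid hL) hΦsurj

end
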